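/- arXiv:2511.07417 — 5 statements merged into one kernel-verified Lean document; each statement's English description precedes it below -/
import Mathlib

section
/- For every countable collection of languages 𝓛 : ℕ → Set ℕ (each 𝓛 i an infinite subset of ℕ), there exists an element-based generator G : List ℕ → ℕ such that for every index i and every enumeration x of K := 𝓛 i with o(1)-noise and arbitrary omissions, there exists n* such that for all n ≥ n*, G(x_1,…,x_n) ∈ K \ {x_1,…,x_n}. -/
open Filter Set Topology

/-- The list `[x 0, …, x (n-1)]` of the first `n` elements of the stream `x`
(the paper's `x_1, …, x_n`). -/
def prefixList (x : ℕ → ℕ) (n : ℕ) : List ℕ := (List.range n).map x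

/-- The set of the first `n` elements of the stream `x` (the paper's `{x_1, …, x_n}`). -/
def seen (x : ℕ → ℕ) (n : ℕ) : Set ℕ := x '' {t | t < n}

/-- The empirical noise rate `R(L; x_{1:n})` of the first `n` elements of `x` w.r.t. `L`. -/
noncomputable def noiseRate (L : Set ℕ) (x : ℕ → ℕ) (n : ℕ) : ℝ :=
  (({t | t < n ∧ x t ∉ L}).ncard : ℝ) / n

/-- `|A ∩ {b_1, …, b_m}| / m` where `b_1 < b_2 < …` is the increasing enumeration of `B`. -/
noncomputable def densityRatio (A B : Set ℕ) (m : ℕ) : ℝ :=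
  (({j | j < m ∧ Nat.nth (· ∈ B) j ∈ A}).ncard : ℝ) / m

/-- Lower density `μ_low(A, B)` of `A` in `B`. -/
noncomputable def lowDensity (A B : Set ℕ) : ℝ := Filter.liminf (densityRatio A B) Filter.atTop

/-- Upper density `μ_up(A, B)` of `A` in `B`. -/
noncomputable def upDensity (A B : Set ℕ) : ℝ := Filter.limsup (densityRatio A B) Filter.atTop

/-- The elements outside `l` lying in every language `𝓛 i` with `i ≤ m` whose empirical
noise on `l` is at most `2 ^ (-(i + 2))`. -/
def candidates (𝓛 : ℕ → Set ℕ) (l : List ℕ) (m : ℕ) : Set ℕ :=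
  {y | y ∉ l ∧ ∀ i ≤ m,
    ({t | t < l.length ∧ l.getD t 0 ∉ 𝓛 i}).ncard * 2 ^ (i + 2) ≤ l.length → y ∈ 𝓛 i}

open Classical in
/-- The generator that outputs a candidate for the largest possible level `m ≤ l.length`. -/
noncomputable def candidateGenerator (𝓛 : ℕ → Set ℕ) (l : List ℕ) : ℕ :=
  if h : (candidates 𝓛 l
      (Nat.findGreatest (fun m => (candidates 𝓛 l m).Nonempty) l.length)).Nonempty
  then h.some else 0

theorem length_prefixList (x : ℕ → ℕ) (n : ℕ) : (prefixList x n).length = n := by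
  simp [prefixList]

theorem mem_prefixList {x : ℕ → ℕ} {n y : ℕ} : y ∈ prefixList x n ↔ y ∈ seen x n := by
  simp [prefixList, seen]

theorem mem_candidates_prefixList {𝓛 : ℕ → Set ℕ} {x : ℕ → ℕ} {n m y : ℕ} :
    y ∈ candidates 𝓛 (prefixList x n) m ↔ y ∉ seen x n ∧ ∀ i ≤ m,
      ({t | t < n ∧ x t ∉ 𝓛 i}).ncard * 2 ^ (i + 2) ≤ n → y ∈ 𝓛 i := by
  have h (i : ℕ) : {t | t < n ∧ (prefixList x n).getD t 0 ∉ 𝓛 i} = {t | t < n ∧ x t ∉ 𝓛 i} := by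
    ext t
    simp only [mem_ofPred_eq, and_congr_right_iff]
    intro ht
    simp [prefixList, ht]
  simp only [candidates, mem_ofPred_eq, length_prefixList, mem_prefixList, h]

/-- Finitely many languages, the `i`-th with noise at most `2 ^ (-(i + 2))` on a long enough
prefix of an injective stream, have infinite intersection. -/
theorem eventually_infinite_iInter (𝓛 : ℕ → Set ℕ) {x : ℕ → ℕ} (hx : Function.Injective x)
    (S : Finset ℕ) :
    ∀ᶠ n in atTop, (∀ i ∈ S, ({t | t < n ∧ x t ∉ 𝓛 i}).ncard * 2 ^ (i + 2) ≤ n) →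
      {y | ∀ i ∈ S, y ∈ 𝓛 i}.Infinite := by
  by_cases hI : {y | ∀ i ∈ S, y ∈ 𝓛 i}.Infinite
  · exact Eventually.of_forall fun _ _ => hI
  rw [not_infinite] at hI
  filter_upwards [eventually_gt_atTop (2 * {y | ∀ i ∈ S, y ∈ 𝓛 i}.ncard)] with n hn hS
  exfalso
  classical
  have hcover : Finset.range n ⊆ (Finset.range n).filter (fun t => ∀ i ∈ S, x t ∈ 𝓛 i) ∪
      S.biUnion fun i => (Finset.range n).filter fun t => x t ∉ 𝓛 i := by
    intro t ht
    by_cases h : ∀ i ∈ S, x t ∈ 𝓛 i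
    · exact Finset.mem_union_left _ (Finset.mem_filter.2 ⟨ht, h⟩)
    · push Not at h
      obtain ⟨i, hi, hti⟩ := h
      exact Finset.mem_union_right _
        (Finset.mem_biUnion.2 ⟨i, hi, Finset.mem_filter.2 ⟨ht, hti⟩⟩)
  have hgood : ((Finset.range n).filter (fun t => ∀ i ∈ S, x t ∈ 𝓛 i)).card ≤
      {y | ∀ i ∈ S, y ∈ 𝓛 i}.ncard := by
    rw [← ncard_coe_finset]
    exact ncard_le_ncard_of_injOn x (by intro t ht; simpa using (by simpa using ht :
      t < n ∧ ∀ i ∈ S, x t ∈ 𝓛 i).2) hx.injOn hI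
  have hcard := (Finset.card_le_card hcover).trans <| (Finset.card_union_le _ _).trans <|
    add_le_add hgood Finset.card_biUnion_le
  rw [Finset.card_range] at hcard
  have hbad : ∀ i ∈ S, (((Finset.range n).filter fun t => x t ∉ 𝓛 i).card : ℝ) ≤
      n / 4 * (1 / 2) ^ i := by
    intro i hi
    have hnat := hS i hi
    have heq : {t | t < n ∧ x t ∉ 𝓛 i} =
        ((Finset.range n).filter fun t => x t ∉ 𝓛 i : Finset ℕ) := by
      ext t; simp
    rw [heq, ncard_coe_finset] at hnat
    have hreal : (((Finset.range n).filter fun t => x t ∉ 𝓛 i).card : ℝ) * 2 ^ (i + 2) ≤ n := by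
      exact_mod_cast hnat
    rw [← le_div_iff₀ (by positivity)] at hreal
    refine hreal.trans (le_of_eq ?_)
    rw [one_div, inv_pow, pow_add]
    field_simp
    norm_num
  have hgeom : ∑ i ∈ S, ((1 : ℝ) / 2) ^ i ≤ 2 := by
    refine (?_ : _ ≤ _).trans tsum_geometric_two.le
    exact summable_geometric_two.sum_le_tsum S fun i _ => by positivity
  have hsum : (∑ i ∈ S, ((Finset.range n).filter fun t => x t ∉ 𝓛 i).card : ℝ) ≤ n / 2 := by
    calc _ ≤ ∑ i ∈ S, (n : ℝ) / 4 * (1 / 2) ^ i := Finset.sum_le_sum hbad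
      _ = n / 4 * ∑ i ∈ S, ((1 : ℝ) / 2) ^ i := by rw [Finset.mul_sum]
      _ ≤ n / 4 * 2 := by gcongr
      _ = n / 2 := by ring
  have hcard' : (n : ℝ) ≤ {y | ∀ i ∈ S, y ∈ 𝓛 i}.ncard +
      ∑ i ∈ S, (((Finset.range n).filter fun t => x t ∉ 𝓛 i).card : ℝ) := by
    exact_mod_cast hcard
  have hn' : 2 * ({y | ∀ i ∈ S, y ∈ 𝓛 i}.ncard : ℝ) < n := by exact_mod_cast hn
  linarith

theorem eventually_candidates_nonempty (𝓛 : ℕ → Set ℕ) {x : ℕ → ℕ} (hx : Function.Injective x)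
    (m : ℕ) : ∀ᶠ n in atTop, (candidates 𝓛 (prefixList x n) m).Nonempty := by
  classical
  have hall : ∀ᶠ n in atTop, ∀ S ∈ (Finset.range (m + 1)).powerset,
      (∀ i ∈ S, ({t | t < n ∧ x t ∉ 𝓛 i}).ncard * 2 ^ (i + 2) ≤ n) →
        {y | ∀ i ∈ S, y ∈ 𝓛 i}.Infinite :=
    (Finset.eventually_all _).2 fun S _ => eventually_infinite_iInter 𝓛 hx S
  filter_upwards [hall] with n hn
  have hinf := hn ((Finset.range (m + 1)).filter fun i =>
    ({t | t < n ∧ x t ∉ 𝓛 i}).ncard * 2 ^ (i + 2) ≤ n)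
    (Finset.mem_powerset.2 (Finset.filter_subset _ _)) fun i hi => (Finset.mem_filter.1 hi).2
  obtain ⟨y, hy, hys⟩ := hinf.exists_notMem_finite ((finite_lt_nat n).image x)
  exact ⟨y, mem_candidates_prefixList.2 ⟨hys, fun i hi hle =>
    hy i (Finset.mem_filter.2 ⟨Finset.mem_range.2 (Nat.lt_succ_of_le hi), hle⟩)⟩⟩

theorem eventually_ncard_mul_two_pow_le {L : Set ℕ} {x : ℕ → ℕ}
    (h : Tendsto (noiseRate L x) atTop (𝓝 0)) (k : ℕ) :
    ∀ᶠ n in atTop, ({t | t < n ∧ x t ∉ L}).ncard * 2 ^ k ≤ n := by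
  have hpos : (0 : ℝ) < 1 / 2 ^ k := by positivity
  filter_upwards [h.eventually_lt_const hpos, eventually_gt_atTop 0] with n hn hn0
  have hn0' : (0 : ℝ) < n := by exact_mod_cast hn0
  rw [noiseRate, div_lt_div_iff₀ hn0' (by positivity), one_mul] at hn
  exact_mod_cast hn.le

theorem candidateGenerator_mem {𝓛 : ℕ → Set ℕ} {l : List ℕ} {m : ℕ} (hm : m ≤ l.length)
    (h : (candidates 𝓛 l m).Nonempty) : candidateGenerator 𝓛 l ∈ candidates 𝓛 l m := by
  classical
  have hne := Nat.findGreatest_spec (P := fun m => (candidates 𝓛 l m).Nonempty) hm h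
  have hle := Nat.le_findGreatest (P := fun m => (candidates 𝓛 l m).Nonempty) hm h
  have hmem : candidateGenerator 𝓛 l ∈ candidates 𝓛 l
      (Nat.findGreatest (fun m => (candidates 𝓛 l m).Nonempty) l.length) := by
    rw [candidateGenerator, dif_pos (by convert hne)]
    convert Set.Nonempty.some_mem _
  exact ⟨hmem.1, fun i hi => hmem.2 i (hi.trans hle)⟩

/-- Generation in the limit is achievable for every countable collection under
`o(1)`-noise and arbitrary omissions. -/
theorem generation_vanishing_noise :
    ∀ 𝓛 : ℕ → Set ℕ, (∀ i, (𝓛 i).Infinite) →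
    ∃ G : List ℕ → ℕ, ∀ i : ℕ, ∀ x : ℕ → ℕ,
      Function.Injective x →
      {n : ℕ | x n ∈ 𝓛 i}.Infinite →
      Filter.Tendsto (noiseRate (𝓛 i) x) Filter.atTop (nhds 0) →
      ∃ nstar : ℕ, ∀ n ≥ nstar, G (prefixList x n) ∈ 𝓛 i \ seen x n := by
  intro 𝓛 _
  refine ⟨candidateGenerator 𝓛, fun i x hx _ hnoise => eventually_atTop.1 ?_⟩
  filter_upwards [eventually_candidates_nonempty 𝓛 hx i,
    eventually_ncard_mul_two_pow_le hnoise (i + 2), eventually_ge_atTop i] with n hne hle hn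
  have hmem := mem_candidates_prefixList.1
    (candidateGenerator_mem (by rwa [length_prefixList]) hne)
  exact ⟨hmem.2 i le_rfl hle, hmem.1⟩
end

section
/- For every c ∈ (0,1) and ε > 0 there exist infinite sets L₁ ⊆ L₂ ⊆ ℕ with μ_low(L₁, L₂) = μ_up(L₁, L₂) = 1 − c such that no set-based generator G : List ℕ → Set ℕ has the following property: for every K ∈ {L₁, L₂} and every injective sequence x : ℕ → ℕ whose range X satisfies X ⊆ K and μ_low(X, K) ≥ 1 − c (an enumeration of K with c-omissions and without noise), G generates in the limit from K under x and limsup_{n→∞} μ_low(G(x_1,…,x_n), K) ≥ 1 − c + ε. -/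
open Filter Set Topology

theorem nth_mem_univ (j : ℕ) : Nat.nth (· ∈ (univ : Set ℕ)) j = j := by
  simp [Nat.nth_true]

theorem densityRatio_nonneg (A B : Set ℕ) (m : ℕ) : 0 ≤ densityRatio A B m := by
  unfold densityRatio; positivity

theorem densityRatio_le_one (A B : Set ℕ) (m : ℕ) : densityRatio A B m ≤ 1 := by
  refine div_le_one_of_le₀ ?_ (Nat.cast_nonneg m)
  have h : ({j | j < m ∧ Nat.nth (· ∈ B) j ∈ A}).ncard ≤ (Set.Iio m).ncard :=
    Set.ncard_le_ncard (fun j hj => hj.1) (Set.finite_Iio m)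
  rw [Set.ncard_Iio_nat] at h
  exact_mod_cast h

theorem densityRatio_mono {A A' : Set ℕ} (h : A ⊆ A') (B : Set ℕ) (m : ℕ) :
    densityRatio A B m ≤ densityRatio A' B m := by
  unfold densityRatio
  gcongr
  · exact (Set.finite_Iio m).subset fun j hj => hj.1

theorem lowDensity_mono {A A' : Set ℕ} (h : A ⊆ A') (B : Set ℕ) :
    lowDensity A B ≤ lowDensity A' B :=
  liminf_le_liminf (Eventually.of_forall (densityRatio_mono h B))
    (isBoundedUnder_of ⟨0, densityRatio_nonneg A B⟩)
    (isBoundedUnder_of ⟨1, densityRatio_le_one A' B⟩).isCoboundedUnder_ge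

theorem lowDensity_nonneg (A B : Set ℕ) : 0 ≤ lowDensity A B :=
  le_liminf_of_le (isBoundedUnder_of ⟨1, densityRatio_le_one A B⟩).isCoboundedUnder_ge
    (Eventually.of_forall (densityRatio_nonneg A B))

theorem lowDensity_self {A : Set ℕ} (hA : A.Infinite) : lowDensity A A = 1 := by
  refine Tendsto.liminf_eq (tendsto_const_nhds.congr' ?_)
  filter_upwards [eventually_gt_atTop 0] with m hm
  have h : {j | j < m ∧ Nat.nth (· ∈ A) j ∈ A} = Set.Iio m := by
    ext j
    exact ⟨fun hj => hj.1, fun hj => ⟨hj, Nat.nth_mem_of_infinite hA j⟩⟩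
  have hm' : (m : ℝ) ≠ 0 := by positivity
  rw [densityRatio, h, Set.ncard_Iio_nat, div_self hm']

/-- The jump set of `n ↦ ⌊a * n⌋₊`, a set of natural density `a` when `0 ≤ a ≤ 1`. -/
def floorJumps (a : ℝ) : Set ℕ := {n | ⌊a * n⌋₊ < ⌊a * (n + 1 : ℕ)⌋₊}

theorem ncard_floorJumps_lt {a : ℝ} (h0 : 0 ≤ a) (h1 : a ≤ 1) (m : ℕ) :
    {j | j < m ∧ j ∈ floorJumps a}.ncard = ⌊a * m⌋₊ := by
  induction m with
  | zero => simp
  | succ m ih =>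
    have hmono : ⌊a * m⌋₊ ≤ ⌊a * (m + 1 : ℕ)⌋₊ := by gcongr; simp
    have hstep : ⌊a * (m + 1 : ℕ)⌋₊ ≤ ⌊a * m⌋₊ + 1 := by
      rw [← Nat.floor_add_one (by positivity)]
      apply Nat.floor_le_floor
      push_cast
      linarith
    by_cases hm : m ∈ floorJumps a
    · have h : {j | j < m + 1 ∧ j ∈ floorJumps a} =
          insert m {j | j < m ∧ j ∈ floorJumps a} := by
        ext j
        simp only [mem_ofPred_eq, mem_insert_iff, Nat.lt_succ_iff_lt_or_eq]
        grind
      rw [h, Set.ncard_insert_of_notMem (by simp)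
        ((Set.finite_Iio m).subset fun j hj => hj.1), ih]
      have : ⌊a * m⌋₊ < ⌊a * (m + 1 : ℕ)⌋₊ := hm
      omega
    · have h : {j | j < m + 1 ∧ j ∈ floorJumps a} = {j | j < m ∧ j ∈ floorJumps a} := by
        ext j
        simp only [mem_ofPred_eq, Nat.lt_succ_iff_lt_or_eq]
        grind
      rw [h, ih]
      have : ¬ ⌊a * m⌋₊ < ⌊a * (m + 1 : ℕ)⌋₊ := hm
      omega

theorem tendsto_densityRatio_floorJumps {a : ℝ} (h0 : 0 ≤ a) (h1 : a ≤ 1) :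
    Tendsto (densityRatio (floorJumps a) univ) atTop (𝓝 a) := by
  refine ((tendsto_nat_floor_mul_div_atTop h0).comp tendsto_natCast_atTop_atTop).congr
    fun m => ?_
  simp only [Function.comp_apply, densityRatio, nth_mem_univ, ncard_floorJumps_lt h0 h1]

theorem infinite_floorJumps {a : ℝ} (h0 : 0 < a) (h1 : a ≤ 1) : (floorJumps a).Infinite := by
  intro hfin
  obtain ⟨m, hm⟩ := exists_nat_gt (((floorJumps a).ncard + 1 : ℝ) / a)
  rw [div_lt_iff₀ h0] at hm
  have hle : ⌊a * m⌋₊ ≤ (floorJumps a).ncard := by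
    rw [← ncard_floorJumps_lt h0.le h1 m]
    exact Set.ncard_le_ncard (fun j hj => hj.2) hfin
  have hlt := Nat.lt_floor_add_one (a * m)
  have : (⌊a * m⌋₊ : ℝ) ≤ (floorJumps a).ncard := by exact_mod_cast hle
  linarith

/-- No set-based generator can beat upper density `1 - c` under `c`-omissions without noise. -/
theorem set_based_upper_density_lower_bound (c : ℝ) (hc : c ∈ Set.Ioo (0:ℝ) 1)
    (ε : ℝ) (hε : 0 < ε) :
    ∃ L₁ L₂ : Set ℕ, L₁.Infinite ∧ L₂.Infinite ∧ L₁ ⊆ L₂ ∧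
      lowDensity L₁ L₂ = 1 - c ∧ upDensity L₁ L₂ = 1 - c ∧
      ∀ G : List ℕ → Set ℕ,
        ¬ (∀ K ∈ ({L₁, L₂} : Set (Set ℕ)), ∀ x : ℕ → ℕ,
            Function.Injective x → Set.range x ⊆ K → lowDensity (Set.range x) K ≥ 1 - c →
            (∃ nstar : ℕ, ∀ n ≥ nstar, G (prefixList x n) ⊆ K \ seen x n) ∧
            Filter.limsup (fun n => lowDensity (G (prefixList x n)) K) Filter.atTop
              ≥ 1 - c + ε) := by
  have h0 : 0 < 1 - c := by linarith [hc.2]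
  have h1 : 1 - c ≤ 1 := by linarith [hc.1]
  have hinf := infinite_floorJumps h0 h1
  have hlim := tendsto_densityRatio_floorJumps h0.le h1
  have hlow : lowDensity (floorJumps (1 - c)) univ = 1 - c := hlim.liminf_eq
  refine ⟨floorJumps (1 - c), univ, hinf, infinite_univ, subset_univ _, hlow,
    hlim.limsup_eq, fun G hG => ?_⟩
  set x := Nat.nth (· ∈ floorJumps (1 - c))
  have hinj : Function.Injective x := Nat.nth_injective hinf
  have hrange : range x = floorJumps (1 - c) := Nat.range_nth_of_infinite hinf
  obtain ⟨⟨N, hN⟩, -⟩ := hG _ (mem_insert _ _) x hinj hrange.subset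
    (by rw [hrange, lowDensity_self hinf]; exact h1)
  obtain ⟨-, hsup⟩ := hG univ (by simp) x hinj (subset_univ _) (by rw [hrange, hlow])
  have hle : limsup (fun n => lowDensity (G (prefixList x n)) univ) atTop ≤ 1 - c := by
    refine limsup_le_of_le
      (isBoundedUnder_of ⟨0, fun n => lowDensity_nonneg _ _⟩).isCoboundedUnder_le ?_
    filter_upwards [eventually_ge_atTop N] with n hn
    exact (lowDensity_mono ((hN n hn).trans sdiff_subset) univ).trans_eq hlow
  linarith
end

section
/- There exist infinite sets L₁ ⊆ L₂ ⊆ ℕ with μ_up(L₁, L₂) = 0 and an injective sequence x : ℕ → ℕ with range equal to L₂ and lim_{n→∞} R(L₁; x_{1:n}) = 0 (so x is simultaneously an enumeration of L₂ without noise or omissions and an enumeration of L₁ with o(1)-noise and without omissions), such that for every function G : List ℕ → ℕ: if there exists N with G(x_1,…,x_n) ∈ L₁ \ {x_1,…,x_n} for all n ≥ N, then the output set W := {G(x_1,…,x_n) : n ∈ ℕ} satisfies μ_up(W, L₂) = 0. Consequently, no element-based generator that generates in the limit from the collection {L₁, L₂} under o(1)-noise enumerations without omissions achieves element-based upper density ρ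 for any ρ > 0 when the target is L₂. -/
open Filter Set Topology

/-- The set of elements of `A` below `m`, divided by `m`: the density ratio in all of `ℕ`. -/
lemma densityRatio_univ (A : Set ℕ) (m : ℕ) :
    densityRatio A Set.univ m = (({j | j < m ∧ j ∈ A}).ncard : ℝ) / m := by
  have h (j : ℕ) : Nat.nth (· ∈ (Set.univ : Set ℕ)) j = j := by
    simp
  simp only [densityRatio, h]

lemma ncard_isSquare_lt_le (m : ℕ) : ({j | j < m ∧ IsSquare j}).ncard ≤ Nat.sqrt m + 1 := by
  have hsub : {j | j < m ∧ IsSquare j} ⊆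
      (((Finset.range (Nat.sqrt m + 1)).image fun k => k * k : Finset ℕ) : Set ℕ) := by
    rintro j ⟨hj, k, rfl⟩
    simp only [Finset.coe_image, Set.mem_image, Finset.mem_coe, Finset.mem_range]
    exact ⟨k, Nat.lt_succ_of_le (Nat.le_sqrt.2 hj.le), rfl⟩
  calc ({j | j < m ∧ IsSquare j}).ncard
      ≤ ((Finset.range (Nat.sqrt m + 1)).image fun k => k * k).card := by
        simpa only [Set.ncard_coe_finset] using
          Set.ncard_le_ncard hsub (Finset.finite_toSet _)
    _ ≤ Nat.sqrt m + 1 := Finset.card_image_le.trans (Finset.card_range _).le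

lemma tendsto_densityRatio_of_subset_squares_union {A F : Set ℕ} (hF : F.Finite)
    (hA : A ⊆ {n | IsSquare n} ∪ F) :
    Tendsto (densityRatio A Set.univ) atTop (𝓝 0) := by
  have hbound (m : ℕ) :
      densityRatio A Set.univ m ≤ √(m : ℝ) / m + (1 + F.ncard : ℝ) / m := by
    rw [densityRatio_univ, ← add_div]
    gcongr
    have hsub : {j | j < m ∧ j ∈ A} ⊆ {j | j < m ∧ IsSquare j} ∪ F := by
      rintro j ⟨hj, hjA⟩
      exact (hA hjA).imp (fun h => ⟨hj, h⟩) id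
    have hfin : {j | j < m ∧ IsSquare j}.Finite := (Set.finite_lt_nat m).subset fun _ h => h.1
    have hle : ({j | j < m ∧ j ∈ A}).ncard ≤ Nat.sqrt m + 1 + F.ncard :=
      (Set.ncard_le_ncard hsub (hfin.union hF)).trans <|
        (Set.ncard_union_le _ _).trans (Nat.add_le_add_right (ncard_isSquare_lt_le m) _)
    have hle' : (({j | j < m ∧ j ∈ A}).ncard : ℝ) ≤ Nat.sqrt m + 1 + F.ncard := by
      exact_mod_cast hle
    linarith [Real.nat_sqrt_le_real_sqrt (a := m)]
  have hsqrt : Tendsto (fun m : ℕ => √(m : ℝ) / m) atTop (𝓝 0) := by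
    simp only [Real.sqrt_div_self]
    exact tendsto_inv_atTop_zero.comp
      (Real.tendsto_sqrt_atTop.comp tendsto_natCast_atTop_atTop)
  refine squeeze_zero (fun m => ?_) hbound ?_
  · unfold densityRatio
    positivity
  · simpa using hsqrt.add (tendsto_const_div_atTop_nhds_zero_nat (1 + F.ncard : ℝ))

/-- A set `S` of naturals that is infinite and co-infinite can be exchanged with its complement
by a permutation of `ℕ`. -/
lemma exists_perm_mem_iff_notMem {S : Set ℕ} (hS : S.Infinite) (hSc : Sᶜ.Infinite) :
    ∃ e : Equiv.Perm ℕ, ∀ n, e n ∈ S ↔ n ∉ S := by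
  classical
  have := hS.to_subtype
  have := hSc.to_subtype
  obtain ⟨f⟩ : Nonempty (S ≃ (Sᶜ : Set ℕ)) := nonempty_equiv_of_countable
  refine ⟨(Equiv.Set.sumCompl S).symm.trans
    (((Equiv.sumCongr f f.symm).trans (Equiv.sumComm _ _)).trans (Equiv.Set.sumCompl S)),
    fun n => ?_⟩
  by_cases hn : n ∈ S
  · have hfn : (f ⟨n, hn⟩ : ℕ) ∉ S := (f ⟨n, hn⟩).2
    simp [Equiv.Set.sumCompl_symm_apply_of_mem hn, hn, hfn]
  · simp [Equiv.Set.sumCompl_symm_apply_of_notMem hn, hn]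

/-- Impossibility of element-based upper density under `o(1)`-noise without omissions. -/
theorem element_based_density_impossible_vanishing_noise :
    ∃ L₁ L₂ : Set ℕ, L₁.Infinite ∧ L₂.Infinite ∧ L₁ ⊆ L₂ ∧ upDensity L₁ L₂ = 0 ∧
      ∃ x : ℕ → ℕ, Function.Injective x ∧ Set.range x = L₂ ∧
        Filter.Tendsto (noiseRate L₁ x) Filter.atTop (nhds 0) ∧
        ∀ G : List ℕ → ℕ,
          (∃ N : ℕ, ∀ n ≥ N, G (prefixList x n) ∈ L₁ \ seen x n) →
          upDensity (Set.range fun n => G (prefixList x n)) L₂ = 0 := by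
  have hS : {n : ℕ | IsSquare n}.Infinite :=
    Set.infinite_of_injective_forall_mem (f := fun k : ℕ => k * k)
      (fun _ _ h => Nat.mul_self_inj.1 h) fun k => ⟨k, rfl⟩
  have hSc : {n : ℕ | IsSquare n}ᶜ.Infinite :=
    Nat.infinite_setOfPred_prime.mono fun _ hp => hp.prime.not_isSquare
  obtain ⟨x, hx⟩ := exists_perm_mem_iff_notMem hS hSc
  have hdens := tendsto_densityRatio_of_subset_squares_union Set.finite_empty
    (A := {n | IsSquare n}) Set.subset_union_left
  refine ⟨{n | IsSquare n}, Set.univ, hS, Set.infinite_univ, Set.subset_univ _,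
    hdens.limsup_eq, x, x.injective, x.surjective.range_eq, ?_, ?_⟩
  · refine hdens.congr fun m => ?_
    simp only [densityRatio_univ, noiseRate, hx, not_not]
  · rintro G ⟨N, hN⟩
    refine (tendsto_densityRatio_of_subset_squares_union
      ((Set.finite_lt_nat N).image fun n => G (prefixList x n)) ?_).limsup_eq
    rintro _ ⟨n, rfl⟩
    rcases lt_or_ge n N with h | h
    · exact Or.inr ⟨n, h, rfl⟩
    · exact Or.inl (hN n h).1
end

section
/- Let M > 0 be a real number, let K ⊆ ℕ be infinite, and let x : ℕ → ℕ be an M-bounded displacement enumeration with respect to K (with arbitrary noise and possible omissions). Then for every L ⊆ K: μ_low(L, K) ≥ (1/M)·liminf_{n→∞} |L ∩ {x_1,…,x_n}|/n and μ_up(L, K) ≥ (1/M)·limsup_{n→∞} |L ∩ {x_1,…,x_n}|/n. -/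
open Filter Set Topology

open Classical in
/-- The 1-indexed position `σ(y, L)` of `y` in the increasing enumeration of `L`
(and `0` if `y ∉ L`). -/
noncomputable def position (y : ℕ) (L : Set ℕ) : ℕ :=
  if y ∈ L then {z | z ∈ L ∧ z ≤ y}.ncard else 0

/-- `x` is an `M`-bounded displacement enumeration w.r.t. `L`:
`σ(x_n, L) ≤ M · n` for all sufficiently large `n` (here `x t` is the `(t+1)`-st element). -/
def MBounded (x : ℕ → ℕ) (L : Set ℕ) (M : ℝ) : Prop :=
  ∃ nstar : ℕ, ∀ n ≥ nstar, (position (x n) L : ℝ) ≤ M * (n + 1)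

lemma ncard_div_mem_Icc {S : Set ℕ} {n : ℕ} (h : S.ncard ≤ n) :
    (S.ncard : ℝ) / n ∈ Icc (0 : ℝ) 1 :=
  ⟨by positivity, div_le_one_of_le₀ (by exact_mod_cast h) (by positivity)⟩

lemma finite_lt_and (p : ℕ → Prop) (m : ℕ) : {j | j < m ∧ p j}.Finite :=
  (finite_lt_nat m).subset fun _ h => h.1

lemma ncard_lt_and_le (p : ℕ → Prop) (m : ℕ) : {j | j < m ∧ p j}.ncard ≤ m := by
  calc {j | j < m ∧ p j}.ncard ≤ (Iio m).ncard :=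
        ncard_le_ncard (fun _ h => h.1) (finite_Iio m)
    _ = m := by rw [ncard_eq_toFinset_card']; simp

lemma ncard_seen_le (x : ℕ → ℕ) (n : ℕ) : (seen x n).ncard ≤ n := by
  refine (ncard_image_le (finite_lt_nat n)).trans ?_
  simpa using ncard_lt_and_le (fun _ => True) n

lemma finite_seen (x : ℕ → ℕ) (n : ℕ) : (seen x n).Finite := (finite_lt_nat n).image x

lemma densityRatio_mem_Icc (A B : Set ℕ) (m : ℕ) : densityRatio A B m ∈ Icc (0 : ℝ) 1 :=
  ncard_div_mem_Icc (ncard_lt_and_le _ m)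

lemma ncard_inter_seen_div_mem_Icc (L : Set ℕ) (x : ℕ → ℕ) (n : ℕ) :
    ((L ∩ seen x n).ncard : ℝ) / n ∈ Icc (0 : ℝ) 1 :=
  ncard_div_mem_Icc
    ((ncard_le_ncard inter_subset_right (finite_seen x n)).trans (ncard_seen_le x n))

open Classical in
lemma position_eq_count_add_one {K : Set ℕ} {y : ℕ} (hy : y ∈ K) :
    position y K = Nat.count (· ∈ K) y + 1 := by
  have h : {z | z ∈ K ∧ z ≤ y} = ↑((Finset.range (y + 1)).filter (· ∈ K)) := by
    ext z
    simp [and_comm]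
  rw [position, if_pos hy, h, ncard_coe_finset, ← Nat.count_eq_card_filter_range,
    Nat.count_succ, if_pos hy]

/-- Apart from at most `N` early terms, the elements of `L` among the first `n` terms of the
stream occupy positions at most `m` in `K`, as soon as `M * n < m + 1`. -/
lemma ncard_inter_seen_le {M : ℝ} (hM : 0 < M) {K L : Set ℕ} (hL : L ⊆ K) {x : ℕ → ℕ} {N : ℕ}
    (hN : ∀ n ≥ N, (position (x n) K : ℝ) ≤ M * (n + 1)) {n m : ℕ} (hnm : M * n < m + 1) :
    (L ∩ seen x n).ncard ≤ N + {j | j < m ∧ Nat.nth (· ∈ K) j ∈ L}.ncard := by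
  classical
  have hsub : L ∩ seen x n ⊆
      seen x N ∪ Nat.nth (· ∈ K) '' {j | j < m ∧ Nat.nth (· ∈ K) j ∈ L} := by
    rintro _ ⟨hyL, t, ht, rfl⟩
    rcases lt_or_ge t N with h | h
    · exact Or.inl ⟨t, h, rfl⟩
    · have hnth : Nat.nth (· ∈ K) (Nat.count (· ∈ K) (x t)) = x t := Nat.nth_count (hL hyL)
      have hpos := hN t h
      rw [position_eq_count_add_one (hL hyL)] at hpos
      have htn : ((t : ℝ) + 1) ≤ n := by exact_mod_cast ht
      have hlt : ((Nat.count (· ∈ K) (x t) + 1 : ℕ) : ℝ) < ((m + 1 : ℕ) : ℝ) := by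
        push_cast at hpos ⊢
        linarith [mul_le_mul_of_nonneg_left htn hM.le]
      refine Or.inr ⟨_, ⟨?_, ?_⟩, hnth⟩
      · exact Nat.succ_lt_succ_iff.mp (Nat.cast_lt.mp hlt)
      · rwa [hnth]
  have hfin := finite_lt_and (fun j => Nat.nth (· ∈ K) j ∈ L) m
  calc (L ∩ seen x n).ncard ≤ _ := ncard_le_ncard hsub ((finite_seen x N).union (hfin.image _))
    _ ≤ _ := ncard_union_le _ _
    _ ≤ _ := add_le_add (ncard_seen_le x N) (ncard_image_le hfin)

/-- An empirical density of at least `r` along the first `n` terms forces a density ratio of at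
least `c` at any large `m` close to `M * n`, whenever `c * M < r`. -/
lemma eventually_le_densityRatio {M : ℝ} (hM : 0 < M) {K L : Set ℕ} (hL : L ⊆ K) {x : ℕ → ℕ}
    (hx : MBounded x K M) {c r : ℝ} (hr : 0 ≤ r) (hcr : c * M < r) :
    ∀ᶠ m : ℕ in atTop, ∀ n : ℕ, M * n < m + 1 → m ≤ M * n + (M + 1) →
      r < ((L ∩ seen x n).ncard : ℝ) / n → c ≤ densityRatio L K m := by
  obtain ⟨N, hN⟩ := hx
  have hlarge : ∀ᶠ m : ℕ in atTop, (M * N + r * (M + 1)) / (r - c * M) ≤ m :=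
    tendsto_natCast_atTop_atTop.eventually_ge_atTop _
  filter_upwards [hlarge, eventually_gt_atTop 0] with m hm hm0 n hnm hmn hrn
  have hm0' : (0 : ℝ) < m := by exact_mod_cast hm0
  have hn0 : (0 : ℝ) < n := by
    rcases n.eq_zero_or_pos with rfl | h
    · simp only [Nat.cast_zero, div_zero] at hrn
      exact absurd hrn hr.not_gt
    · exact_mod_cast h
  rw [lt_div_iff₀ hn0] at hrn
  rw [div_le_iff₀ (sub_pos.mpr hcr)] at hm
  have hcard : ((L ∩ seen x n).ncard : ℝ) ≤
      N + ({j | j < m ∧ Nat.nth (· ∈ K) j ∈ L}.ncard : ℝ) := by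
    exact_mod_cast ncard_inter_seen_le hM hL hN hnm
  rw [densityRatio, le_div_iff₀ hm0']
  refine le_of_mul_le_mul_left ?_ hM
  have h1 := mul_le_mul_of_nonneg_left hmn hr
  have h2 := mul_le_mul_of_nonneg_left (hrn.le.trans hcard) hM.le
  linarith

/-- Change of density: under an `M`-bounded displacement enumeration of `K`, the density
of `L ⊆ K` in `K` is at least `1/M` times its empirical density along the enumeration. -/
theorem change_of_density (M : ℝ) (hM : 0 < M) (K : Set ℕ) (hK : K.Infinite)
    (x : ℕ → ℕ) (hx : MBounded x K M) :
    ∀ L ⊆ K,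
      lowDensity L K ≥
        (1 / M) * Filter.liminf (fun n : ℕ => ((L ∩ seen x n).ncard : ℝ) / n) Filter.atTop ∧
      upDensity L K ≥
        (1 / M) * Filter.limsup (fun n : ℕ => ((L ∩ seen x n).ncard : ℝ) / n) Filter.atTop := by
  intro L hL
  have hbdd : ∀ {f : ℕ → ℝ}, (∀ n, f n ∈ Icc (0 : ℝ) 1) →
      IsBoundedUnder (· ≤ ·) atTop f ∧ IsBoundedUnder (· ≥ ·) atTop f := fun hf =>
    ⟨isBoundedUnder_of ⟨1, fun n => (hf n).2⟩, isBoundedUnder_of ⟨0, fun n => (hf n).1⟩⟩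
  obtain ⟨hd_le, hd_ge⟩ := hbdd (densityRatio_mem_Icc L K)
  obtain ⟨he_le, he_ge⟩ := hbdd (ncard_inter_seen_div_mem_Icc L x)
  constructor
  · refine le_of_forall_lt_imp_le_of_dense fun c hc => ?_
    refine le_liminf_of_le hd_le.isCoboundedUnder_ge ?_
    rcases lt_or_ge c 0 with hc0 | hc0
    · exact Eventually.of_forall fun m => hc0.le.trans (densityRatio_mem_Icc L K m).1
    rw [one_div_mul_eq_div, lt_div_iff₀ hM] at hc
    obtain ⟨r, hcr, hr⟩ := exists_between hc
    have hr0 : 0 ≤ r := (mul_nonneg hc0 hM.le).trans hcr.le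
    have htend : Tendsto (fun m : ℕ => ⌊(m : ℝ) / M⌋₊) atTop atTop :=
      tendsto_nat_floor_atTop.comp (tendsto_natCast_atTop_atTop.atTop_div_const hM)
    filter_upwards [eventually_le_densityRatio hM hL hx hr0 hcr,
      htend.eventually (eventually_lt_of_lt_liminf hr he_ge)] with m hm hrm
    have h1 : (⌊(m : ℝ) / M⌋₊ : ℝ) ≤ m / M := Nat.floor_le (by positivity)
    have h2 : (m : ℝ) / M < ⌊(m : ℝ) / M⌋₊ + 1 := Nat.lt_floor_add_one _
    rw [le_div_iff₀ hM] at h1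
    rw [div_lt_iff₀ hM] at h2
    exact hm _ (by linarith) (by linarith) hrm
  · refine le_of_forall_lt_imp_le_of_dense fun c hc => ?_
    refine le_limsup_of_frequently_le ?_ hd_le
    rcases lt_or_ge c 0 with hc0 | hc0
    · exact Frequently.of_forall fun m => hc0.le.trans (densityRatio_mem_Icc L K m).1
    rw [one_div_mul_eq_div, lt_div_iff₀ hM] at hc
    obtain ⟨r, hcr, hr⟩ := exists_between hc
    have hr0 : 0 ≤ r := (mul_nonneg hc0 hM.le).trans hcr.le
    have htend : Tendsto (fun n : ℕ => ⌈M * (n : ℝ)⌉₊) atTop atTop :=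
      tendsto_nat_ceil_atTop.comp (tendsto_natCast_atTop_atTop.const_mul_atTop hM)
    refine htend.frequently ?_
    refine ((frequently_lt_of_lt_limsup he_ge.isCoboundedUnder_le hr).and_eventually
      (htend.eventually (eventually_le_densityRatio hM hL hx hr0 hcr))).mono ?_
    rintro n ⟨hrn, hm⟩
    have h1 : M * (n : ℝ) ≤ ⌈M * (n : ℝ)⌉₊ := Nat.le_ceil _
    have h2 : (⌈M * (n : ℝ)⌉₊ : ℝ) < M * n + 1 := Nat.ceil_lt_add_one (by positivity)
    exact hm n (by linarith) (by linarith) hrn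
end

section
/- Let 𝓒 := {ℕ} ∪ {ℕ \ {m} : m ∈ ℕ}. For every real M > 1 and every function G : List ℕ → Set ℕ, there exist a language K ∈ 𝓒 and an injective sequence x : ℕ → ℕ with range(x) = K that is an M-bounded displacement enumeration with respect to K, such that it is NOT the case that there exists N with G(x_1,…,x_n) = K for all n ≥ N. In other words, identification in the limit of the collection 𝓒 is impossible even when the adversary is restricted to M-bounded enumerations without noise or omissions. -/
open Filter Set Topology

open Classical in
/-- The state of the adversary after `n` steps: the list presented so far, and the unique element
of `{0, …, n}` that is withheld. Once the learner `G` conjectures `ℕ` without the withheld element,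
that element is presented and the next one is withheld. -/
noncomputable def adversaryState (G : List ℕ → Set ℕ) : ℕ → List ℕ × ℕ
  | 0 => ([], 0)
  | n + 1 =>
    let s := adversaryState G n
    if G s.1 = Set.univ \ {s.2} then (s.1 ++ [s.2], n + 1) else (s.1 ++ [n + 1], s.2)

/-- The element withheld by the adversary after `n` steps. -/
noncomputable def withheld (G : List ℕ → Set ℕ) (n : ℕ) : ℕ := (adversaryState G n).2

open Classical in
/-- The stream presented by the adversary. -/
noncomputable def adversaryStream (G : List ℕ → Set ℕ) (n : ℕ) : ℕ :=
  if G (adversaryState G n).1 = Set.univ \ {withheld G n} then withheld G n else n + 1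

theorem adversaryState_fst (G : List ℕ → Set ℕ) (n : ℕ) :
    (adversaryState G n).1 = prefixList (adversaryStream G) n := by
  induction n with
  | zero => rfl
  | succ n ih =>
    have h : prefixList (adversaryStream G) (n + 1) =
        (adversaryState G n).1 ++ [adversaryStream G n] := by
      rw [ih]; simp [prefixList, List.range_succ]
    rw [h, adversaryState, adversaryStream, withheld]
    split_ifs <;> rfl

theorem adversaryStream_of_eq {G : List ℕ → Set ℕ} {n : ℕ}
    (h : G (prefixList (adversaryStream G) n) = Set.univ \ {withheld G n}) :
    adversaryStream G n = withheld G n := by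
  rw [← adversaryState_fst] at h
  rw [adversaryStream, if_pos h]

theorem adversaryStream_of_ne {G : List ℕ → Set ℕ} {n : ℕ}
    (h : G (prefixList (adversaryStream G) n) ≠ Set.univ \ {withheld G n}) :
    adversaryStream G n = n + 1 := by
  rw [← adversaryState_fst] at h
  rw [adversaryStream, if_neg h]

theorem withheld_succ_of_eq {G : List ℕ → Set ℕ} {n : ℕ}
    (h : G (prefixList (adversaryStream G) n) = Set.univ \ {withheld G n}) :
    withheld G (n + 1) = n + 1 := by
  rw [← adversaryState_fst, withheld] at h
  simp [withheld, adversaryState, h]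

theorem withheld_succ_of_ne {G : List ℕ → Set ℕ} {n : ℕ}
    (h : G (prefixList (adversaryStream G) n) ≠ Set.univ \ {withheld G n}) :
    withheld G (n + 1) = withheld G n := by
  rw [← adversaryState_fst, withheld] at h
  simp [withheld, adversaryState, h]

theorem withheld_le (G : List ℕ → Set ℕ) (n : ℕ) : withheld G n ≤ n := by
  induction n with
  | zero => exact le_rfl
  | succ n ih =>
    by_cases h : G (prefixList (adversaryStream G) n) = Set.univ \ {withheld G n}
    · exact (withheld_succ_of_eq h).le
    · rw [withheld_succ_of_ne h]; omega

theorem seen_succ (x : ℕ → ℕ) (n : ℕ) : seen x (n + 1) = insert (x n) (seen x n) := by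
  have h : {t | t < n + 1} = insert n {t | t < n} := by
    ext t; simp only [Set.mem_ofPred_eq, Set.mem_insert_iff]; omega
  rw [seen, h, Set.image_insert_eq, seen]

theorem mem_seen_adversaryStream (G : List ℕ → Set ℕ) (n k : ℕ) :
    k ∈ seen (adversaryStream G) n ↔ k ≤ n ∧ k ≠ withheld G n := by
  induction n with
  | zero =>
    have h := withheld_le G 0
    have h0 : k ∉ seen (adversaryStream G) 0 := by simp [seen]
    simp only [h0, false_iff]
    omega
  | succ n ih =>
    have hle := withheld_le G n
    rw [seen_succ, Set.mem_insert_iff, ih]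
    by_cases h : G (prefixList (adversaryStream G) n) = Set.univ \ {withheld G n}
    · rw [withheld_succ_of_eq h, adversaryStream_of_eq h]; omega
    · rw [withheld_succ_of_ne h, adversaryStream_of_ne h]; omega

theorem adversaryStream_le (G : List ℕ → Set ℕ) (n : ℕ) : adversaryStream G n ≤ n + 1 := by
  have h : adversaryStream G n ∈ seen (adversaryStream G) (n + 1) := ⟨n, n.lt_succ_self, rfl⟩
  exact ((mem_seen_adversaryStream G _ _).1 h).1

theorem adversaryStream_notMem_seen (G : List ℕ → Set ℕ) (n : ℕ) :
    adversaryStream G n ∉ seen (adversaryStream G) n := by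
  rw [mem_seen_adversaryStream]
  by_cases h : G (prefixList (adversaryStream G) n) = Set.univ \ {withheld G n}
  · simp [adversaryStream_of_eq h]
  · simp [adversaryStream_of_ne h]

theorem adversaryStream_injective (G : List ℕ → Set ℕ) :
    Function.Injective (adversaryStream G) :=
  .of_lt_imp_ne fun a b hab h =>
    adversaryStream_notMem_seen G b ⟨a, hab, h⟩

theorem position_le (y : ℕ) (L : Set ℕ) : position y L ≤ y + 1 := by
  unfold position
  split_ifs
  · calc {z | z ∈ L ∧ z ≤ y}.ncard ≤ (Set.Iic y).ncard :=
          Set.ncard_le_ncard (fun z hz => hz.2) (Set.finite_Iic y)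
      _ = y + 1 := by simp [Set.ncard_eq_toFinset_card']
  · exact Nat.zero_le _

theorem mBounded_of_le_succ {x : ℕ → ℕ} (hx : ∀ n, x n ≤ n + 1) (L : Set ℕ) {M : ℝ}
    (hM : 1 < M) : MBounded x L M := by
  obtain ⟨N, hN⟩ := exists_nat_ge (1 / (M - 1))
  refine ⟨N, fun n hn => ?_⟩
  have hpos : (position (x n) L : ℝ) ≤ n + 2 := by
    exact_mod_cast (position_le (x n) L).trans (Nat.succ_le_succ (hx n))
  have hn' : 1 / (M - 1) ≤ n := hN.trans (by exact_mod_cast hn)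
  rw [div_le_iff₀ (by linarith)] at hn'
  nlinarith

/-- Identification in the limit is impossible for `{ℕ} ∪ {ℕ \ {m}}` even restricted to
`M`-bounded enumerations without noise or omissions, for any `M > 1`. -/
theorem identification_hard_under_bounded_adversary (M : ℝ) (hM : 1 < M)
    (G : List ℕ → Set ℕ) :
    ∃ K ∈ insert (Set.univ : Set ℕ) {L : Set ℕ | ∃ m : ℕ, L = Set.univ \ {m}},
      ∃ x : ℕ → ℕ, Function.Injective x ∧ Set.range x = K ∧ MBounded x K M ∧
        ¬ ∃ N : ℕ, ∀ n ≥ N, G (prefixList x n) = K := by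
  have hbound (L : Set ℕ) : MBounded (adversaryStream G) L M :=
    mBounded_of_le_succ (adversaryStream_le G) L hM
  by_cases hinf : ∀ N, ∃ n ≥ N,
      G (prefixList (adversaryStream G) n) = Set.univ \ {withheld G n}
  · refine ⟨Set.univ, Set.mem_insert _ _, adversaryStream G, adversaryStream_injective G,
      Set.eq_univ_of_forall fun k => ?_, hbound _, ?_⟩
    · obtain ⟨n, hn, h⟩ := hinf k
      have hk : k ∈ seen (adversaryStream G) (n + 1) := by
        rw [mem_seen_adversaryStream, withheld_succ_of_eq h]; omega
      exact Set.image_subset_range _ _ hk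
    · rintro ⟨N, hN⟩
      obtain ⟨n, hn, h⟩ := hinf N
      have hmem : withheld G n ∈ Set.univ \ {withheld G n} := by
        rw [← h, hN n hn]; trivial
      exact hmem.2 rfl
  · push Not at hinf
    obtain ⟨N, hN⟩ := hinf
    have hconst : ∀ n ≥ N, withheld G n = withheld G N := fun n hn => by
      induction n, hn using Nat.le_induction with
      | base => rfl
      | succ n hn ih => rw [withheld_succ_of_ne (hN n hn), ih]
    refine ⟨Set.univ \ {withheld G N}, Set.mem_insert_of_mem _ ⟨_, rfl⟩, adversaryStream G,
      adversaryStream_injective G, Set.ext fun k => ⟨?_, fun hk => ?_⟩, hbound _, ?_⟩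
    · rintro ⟨t, rfl⟩
      have ht : adversaryStream G t ∈ seen (adversaryStream G) (max N (t + 1)) :=
        ⟨t, Nat.lt_of_succ_le (le_max_right _ _), rfl⟩
      rw [mem_seen_adversaryStream, hconst _ (le_max_left _ _)] at ht
      exact ⟨trivial, ht.2⟩
    · have hk' : k ∈ seen (adversaryStream G) (max N k) := by
        rw [mem_seen_adversaryStream, hconst _ (le_max_left _ _)]
        exact ⟨le_max_right _ _, hk.2⟩
      exact Set.image_subset_range _ _ hk'
    · rintro ⟨N', hN'⟩
      refine hN (max N N') (le_max_left _ _) ?_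
      rw [hN' _ (le_max_right _ _), hconst _ (le_max_left _ _)]
end
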